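/- Let G be a finite simple connected (q+1)-regular graph with n vertices and m edges, let a ∈ [0,1] and b ∈ ℝ, set η = (1−q)a + b(q+1) and σ = b((1−q)a + bq), and let Ũ be the generalized Grover matrix of G. Then every complex eigenvalue λ of Ũ satisfies either λ = b, or λ = −b, or λ² − μηλ + σ = 0 for some eigenvalue μ of P(G); moreover, if m > n, then b and −b are both eigenvalues of Ũ, each of algebraic multiplicity at least m − n. -/

import Mathlib

open Matrix BigOperators Polynomial

/-- The generalized Grover matrix `Ũ` of a graph `G` (real parameters `a`, `b`),
viewed as a complex matrix. -/
noncomputable def gGroverMatrix {V : Type*} [Fintype V] [DecidableEq V] (G : SimpleGraph V)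
    [DecidableRel G.Adj] (a b : ℝ) : Matrix G.Dart G.Dart ℂ :=
  fun e f =>
    if f = e.symm then (2 / (G.degree f.snd : ℂ) - 1) * (a : ℂ)
    else if f.snd = e.fst then (2 / (G.degree f.snd : ℂ) - 1) * (a : ℂ) + (b : ℂ)
    else 0

/-- The transition probability matrix of the simple random walk on `G`. -/
noncomputable def transMatrix {V : Type*} [Fintype V] [DecidableEq V] (G : SimpleGraph V)
    [DecidableRel G.Adj] : Matrix V V ℂ :=
  fun u v => if G.Adj u v then 1 / (G.degree u : ℂ) else 0

namespace SimpleGraph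

section dartExtend

variable {V : Type*} [DecidableEq V] {G : SimpleGraph V}

/-- Functions on edges, extended to darts so that reversal acts by the sign `s`. -/
noncomputable def dartExtend (o : G.edgeSet → G.Dart) (s : ℂ) :
    (G.edgeSet → ℂ) →ₗ[ℂ] (G.Dart → ℂ) where
  toFun y f := (if f = o ⟨f.edge, f.edge_mem⟩ then 1 else s) * y ⟨f.edge, f.edge_mem⟩
  map_add' y z := by
    ext f
    simp [mul_add]
  map_smul' c y := by
    ext f
    simp [mul_left_comm]

lemma dartExtend_apply (o : G.edgeSet → G.Dart) (s : ℂ) (y : G.edgeSet → ℂ) (f : G.Dart) :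
    dartExtend o s y f =
      (if f = o ⟨f.edge, f.edge_mem⟩ then 1 else s) * y ⟨f.edge, f.edge_mem⟩ := rfl

lemma dartExtend_injective {o : G.edgeSet → G.Dart} (ho : ∀ e, (o e).edge = e) (s : ℂ) :
    Function.Injective (dartExtend o s) := by
  intro y z h
  ext e
  have he : (⟨(o e).edge, (o e).edge_mem⟩ : G.edgeSet) = e := Subtype.ext (ho e)
  simpa [dartExtend_apply, he] using congrFun h (o e)

lemma dartExtend_symm {o : G.edgeSet → G.Dart} (ho : ∀ e, (o e).edge = e) {s : ℂ}
    (hs : s * s = 1) (y : G.edgeSet → ℂ) (f : G.Dart) :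
    dartExtend o s y f.symm = s * dartExtend o s y f := by
  simp only [dartExtend_apply, Dart.edge_symm]
  rcases (dart_edge_eq_iff _ _).1 (ho ⟨f.edge, f.edge_mem⟩) with h | h
  · simp [h, f.symm_ne]
  · simp [h, f.symm_ne.symm, ← mul_assoc, hs]

end dartExtend

variable {V : Type*} [Fintype V] [DecidableEq V] (G : SimpleGraph V) [DecidableRel G.Adj]

/-- The sum of a function on darts over the darts ending at a given vertex. -/
noncomputable def inSum : (G.Dart → ℂ) →ₗ[ℂ] (V → ℂ) where
  toFun x v := ∑ f : G.Dart, if f.snd = v then x f else 0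
  map_add' x y := by
    ext v
    simp only [Pi.add_apply, ← Finset.sum_add_distrib]
    exact Finset.sum_congr rfl fun f _ => by split_ifs <;> simp
  map_smul' c x := by
    ext v
    simp [Finset.mul_sum]

lemma inSum_apply (x : G.Dart → ℂ) (v : V) :
    G.inSum x v = ∑ f : G.Dart, if f.snd = v then x f else 0 := rfl

lemma inSum_comp_fst (g : V → ℂ) (v : V) :
    G.inSum (fun f => g f.fst) v = ∑ u, if G.Adj v u then g u else 0 := by
  rw [inSum_apply, ← Finset.sum_filter, ← Finset.sum_filter]
  refine Finset.sum_bij (fun f _ => f.fst) ?_ ?_ ?_ fun _ _ => rfl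
  · rintro ⟨⟨u, w⟩, h⟩ hf
    obtain rfl : w = v := by simpa using hf
    simpa using h.symm
  · rintro ⟨⟨u, w⟩, h⟩ hf ⟨⟨u', w'⟩, h'⟩ hf' huv
    obtain rfl : w = v := by simpa using hf
    obtain rfl : w' = w := by simpa using hf'
    obtain rfl : u = u' := huv
    rfl
  · intro u hu
    have hadj : G.Adj v u := by simpa using hu
    exact ⟨⟨(u, v), hadj.symm⟩, by simp, rfl⟩

lemma inSum_comp_snd (g : V → ℂ) (v : V) :
    G.inSum (fun f => g f.snd) v = G.degree v * g v := by
  have h := G.inSum_comp_fst (fun _ => g v) v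
  rw [← Finset.sum_filter, Finset.sum_const, ← neighborFinset_eq_filter,
    card_neighborFinset_eq_degree, nsmul_eq_mul] at h
  rw [← h, inSum_apply, inSum_apply]
  exact Finset.sum_congr rfl fun f _ => by split_ifs with hf <;> simp [hf]

lemma transMatrix_mulVec (g : V → ℂ) (v : V) :
    (transMatrix G *ᵥ g) v = (G.degree v : ℂ)⁻¹ * G.inSum (fun f => g f.fst) v := by
  simp [inSum_comp_fst, mulVec, dotProduct, transMatrix, Finset.mul_sum]

variable {G} {d : ℕ}

lemma IsRegularOfDegree.mul_transMatrix_mulVec (hd : d ≠ 0) (hreg : G.IsRegularOfDegree d)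
    (g : V → ℂ) (v : V) :
    d * (transMatrix G *ᵥ g) v = G.inSum (fun f => g f.fst) v := by
  rw [transMatrix_mulVec, hreg.degree_eq, mul_inv_cancel_left₀ (by exact_mod_cast hd)]

lemma IsRegularOfDegree.gGroverMatrix_mulVec (hreg : G.IsRegularOfDegree d) (a b : ℝ)
    (x : G.Dart → ℂ) (e : G.Dart) :
    (gGroverMatrix G a b *ᵥ x) e =
      ((2 / (d : ℂ) - 1) * a + b) * G.inSum x e.fst - b * x e.symm := by
  have hx : b * x e.symm = ∑ f : G.Dart, if f = e.symm then b * x f else 0 := by simp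
  rw [hx, inSum_apply, Finset.mul_sum, ← Finset.sum_sub_distrib]
  refine Finset.sum_congr rfl fun f _ => ?_
  simp only [gGroverMatrix, hreg.degree_eq]
  by_cases h : f = e.symm
  · subst h
    simp
    ring
  · simp only [h, if_false]
    split_ifs <;> simp

/-- The random walk acts by a scalar on the incoming sums of an eigenvector of the generalized
Grover matrix. -/
lemma IsRegularOfDegree.mul_transMatrix_mulVec_inSum (hd : d ≠ 0)
    (hreg : G.IsRegularOfDegree d) {a b : ℝ} {lam : ℂ} {x : G.Dart → ℂ}
    (hx : gGroverMatrix G a b *ᵥ x = lam • x) (v : V) :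
    lam * (((2 / (d : ℂ) - 1) * a + b) * d) * (transMatrix G *ᵥ G.inSum x) v =
      (lam ^ 2 + b * (((2 / (d : ℂ) - 1) * a + b) * d - b)) * G.inSum x v := by
  set k : ℂ := (2 / (d : ℂ) - 1) * a + b with hk
  have hx' : lam • x = k • (fun e : G.Dart => G.inSum x e.fst) -
      (b : ℂ) • (fun e : G.Dart => x e.symm) := by
    ext e
    rw [← hx, hreg.gGroverMatrix_mulVec]
    simp [hk]
  have hsymm : lam • (fun e : G.Dart => x e.symm) =
      k • (fun e : G.Dart => G.inSum x e.snd) - (b : ℂ) • x := by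
    ext e
    simpa using congrFun hx' e.symm
  have h₁ := congrFun (congrArg G.inSum hx') v
  have h₂ := congrFun (congrArg G.inSum hsymm) v
  simp only [map_sub, map_smul, Pi.sub_apply, Pi.smul_apply, smul_eq_mul, inSum_comp_snd,
    hreg.degree_eq, ← hreg.mul_transMatrix_mulVec hd] at h₁ h₂
  linear_combination (-lam) * h₁ + (b : ℂ) * h₂

lemma IsRegularOfDegree.card_sub_le_rootMultiplicity (hreg : G.IsRegularOfDegree d) (a b : ℝ)
    {s : ℂ} (hs : s * s = 1) :
    G.edgeFinset.card - Fintype.card V ≤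
      (gGroverMatrix G a b).charpoly.rootMultiplicity (-(s * b)) := by
  have hex (e : G.edgeSet) : ∃ f : G.Dart, f.edge = e := by
    obtain ⟨e, he⟩ := e
    induction e using Sym2.ind with
    | _ u v => exact ⟨⟨(u, v), he⟩, rfl⟩
  choose o ho using hex
  set T := G.inSum ∘ₗ dartExtend o s
  have hker : T.ker.map (dartExtend o s) ≤
      Module.End.eigenspace (gGroverMatrix G a b).toLin' (-(s * b)) := by
    rintro _ ⟨y, hy, rfl⟩
    have hy' : G.inSum (dartExtend o s y) = 0 := hy
    rw [Module.End.mem_eigenspace_iff, toLin'_apply]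
    ext e
    rw [hreg.gGroverMatrix_mulVec, hy', dartExtend_symm ho hs]
    simp
    ring
  have hrank := T.finrank_range_add_finrank_ker
  have hrange := Submodule.finrank_le T.range
  rw [Module.finrank_fintype_fun_eq_card, ← edgeFinset_card] at hrank
  rw [Module.finrank_fintype_fun_eq_card] at hrange
  have hmap := (T.ker.equivMapOfInjective _ (dartExtend_injective ho s)).finrank_eq
  have hmono := Submodule.finrank_mono hker
  have hle := LinearMap.finrank_eigenspace_le (gGroverMatrix G a b).toLin' (-(s * b))
  rw [charpoly_toLin'] at hle
  omega

end SimpleGraph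

lemma Matrix.mem_spectrum_iff_exists_mulVec {n : Type*} [Fintype n] [DecidableEq n]
    {A : Matrix n n ℂ} {r : ℂ} : r ∈ spectrum ℂ A ↔ ∃ x ≠ 0, A *ᵥ x = r • x := by
  rw [← spectrum_toLin', ← Module.End.hasEigenvalue_iff_mem_spectrum]
  constructor
  · intro h
    obtain ⟨x, hx⟩ := h.exists_hasEigenvector
    exact ⟨x, hx.2, by simpa using hx.apply_eq_smul⟩
  · rintro ⟨x, hx, h⟩
    exact Module.End.hasEigenvalue_of_hasEigenvector
      ⟨Module.End.mem_eigenspace_iff.2 (by simpa using h), hx⟩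

/-- **Spectrum of the generalized Grover matrix of a regular graph.**
Every complex eigenvalue `λ` of `Ũ` satisfies `λ = b`, `λ = -b`, or
`λ² - μηλ + σ = 0` for some eigenvalue `μ` of `P`; moreover, if `m > n`, then `b` and
`-b` are both eigenvalues of `Ũ`, each of algebraic multiplicity at least `m - n`. -/
theorem gGrover_spectrum {V : Type*} [Fintype V] [DecidableEq V] (G : SimpleGraph V)
    [DecidableRel G.Adj] (hG : G.Connected) (q : ℕ)
    (hreg : G.IsRegularOfDegree (q + 1)) (a b : ℝ) (ha : a ∈ Set.Icc (0 : ℝ) 1)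
    (η σ : ℂ) (hη : η = (1 - (q : ℂ)) * (a : ℂ) + (b : ℂ) * ((q : ℂ) + 1))
    (hσ : σ = (b : ℂ) * ((1 - (q : ℂ)) * (a : ℂ) + (b : ℂ) * (q : ℂ))) :
    (∀ lam ∈ spectrum ℂ (gGroverMatrix G a b),
        lam = (b : ℂ) ∨ lam = -(b : ℂ) ∨
          ∃ μ ∈ spectrum ℂ (transMatrix G), lam ^ 2 - μ * η * lam + σ = 0) ∧
    (Fintype.card V < G.edgeFinset.card →
      (b : ℂ) ∈ spectrum ℂ (gGroverMatrix G a b) ∧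
      (-(b : ℂ)) ∈ spectrum ℂ (gGroverMatrix G a b) ∧
      (X - C (b : ℂ)) ^ (G.edgeFinset.card - Fintype.card V) ∣
        (gGroverMatrix G a b).charpoly ∧
      (X + C (b : ℂ)) ^ (G.edgeFinset.card - Fintype.card V) ∣
        (gGroverMatrix G a b).charpoly) := by
  have hq : (q : ℂ) + 1 ≠ 0 := by exact_mod_cast q.succ_ne_zero
  have hη' : ((2 / ((q + 1 : ℕ) : ℂ) - 1) * a + b) * ((q + 1 : ℕ) : ℂ) = η := by
    rw [hη]
    push_cast
    field_simp
    ring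
  have hσ' : (b : ℂ) * (η - b) = σ := by
    rw [hη, hσ]
    ring
  refine ⟨fun lam hlam => ?_, fun hcard => ?_⟩
  · obtain ⟨x, hx0, hx⟩ := mem_spectrum_iff_exists_mulVec.1 hlam
    by_cases hφ : G.inSum x = 0
    · have hsymm (e : G.Dart) : lam * x e = -(b * x e.symm) := by
        have h := congrFun hx e
        rw [hreg.gGroverMatrix_mulVec, hφ] at h
        simpa using h.symm
      obtain ⟨e, he⟩ := Function.ne_iff.1 hx0
      have h₁ := hsymm e
      have h₂ := hsymm e.symm
      rw [SimpleGraph.Dart.symm_symm] at h₂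
      have hsq : lam ^ 2 = (b : ℂ) ^ 2 := by
        apply mul_right_cancel₀ he
        linear_combination lam * h₁ - (b : ℂ) * h₂
      rcases sq_eq_sq_iff_eq_or_eq_neg.1 hsq with h | h
      · exact .inl h
      · exact .inr (.inl h)
    · have key := hreg.mul_transMatrix_mulVec_inSum q.succ_ne_zero hx
      simp only [hη', hσ'] at key
      refine .inr (.inr ?_)
      by_cases h0 : lam * η = 0
      · obtain ⟨v, hv⟩ := Function.ne_iff.1 hφ
        have hlam' : lam ^ 2 + σ = 0 := by
          have h := key v
          rw [h0, zero_mul, eq_comm, mul_eq_zero] at h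
          exact h.resolve_right hv
        have : Nonempty V := ⟨v⟩
        obtain ⟨μ, hμ⟩ := spectrum.nonempty_of_isAlgClosed_of_finiteDimensional ℂ (transMatrix G)
        exact ⟨μ, hμ, by linear_combination hlam' - μ * h0⟩
      · refine ⟨(lam ^ 2 + σ) / (lam * η),
          mem_spectrum_iff_exists_mulVec.2 ⟨G.inSum x, hφ, ?_⟩, ?_⟩
        · ext v
          rw [Pi.smul_apply, smul_eq_mul, div_mul_eq_mul_div, eq_div_iff h0, ← key v, mul_comm]
        · have h : (lam ^ 2 + σ) / (lam * η) * (lam * η) = lam ^ 2 + σ := div_mul_cancel₀ _ h0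
          linear_combination -h
  · have hne : (gGroverMatrix G a b).charpoly ≠ 0 := (charpoly_monic _).ne_zero
    have hpos := hreg.card_sub_le_rootMultiplicity a b (s := -1) (by norm_num)
    have hneg := hreg.card_sub_le_rootMultiplicity a b (s := 1) (by norm_num)
    rw [neg_one_mul, neg_neg] at hpos
    rw [one_mul] at hneg
    refine ⟨mem_spectrum_iff_isRoot_charpoly.2 ((rootMultiplicity_pos hne).1 (by omega)),
      mem_spectrum_iff_isRoot_charpoly.2 ((rootMultiplicity_pos hne).1 (by omega)),
      (le_rootMultiplicity_iff hne).1 hpos, ?_⟩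
    simpa using (le_rootMultiplicity_iff hne).1 hneg
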